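/- Let G be a finite simple graph with at least one edge and maximum degree Δ(G) ≤ 2. Then χ_{vi,1}(G) = 4 if and only if every connected component of G is either a cycle whose order is divisible by 4 or a path. -/

import Mathlib

open SimpleGraph

variable {V : Type*}

/-- An *incidence* of `G`: a pair `(v, e)` where `e` is an edge of `G` and `v ∈ e`. -/
abbrev Inc (G : SimpleGraph V) : Type _ :=
  {p : V × Sym2 V // p.2 ∈ G.edgeSet ∧ p.1 ∈ p.2}

/-- The elements to be colored in a vi-simultaneous coloring: vertices together with
incidences. -/
abbrev VIElem (G : SimpleGraph V) : Type _ := V ⊕ Inc G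

/-- Adjacency between elements of `V(G) ∪ I(G)`: two vertices are adjacent when they are
adjacent in `G`; a vertex `u` and an incidence `(w, f)` are adjacent when `u ∈ f`; two
distinct incidences `(v, e)`, `(w, f)` are adjacent when `v = w`, or `e = f`, or
`{v, w} = e`, or `{v, w} = f`. -/
def VIAdj (G : SimpleGraph V) : VIElem G → VIElem G → Prop
  | Sum.inl u, Sum.inl w => G.Adj u w
  | Sum.inl u, Sum.inr i => u ∈ i.1.2
  | Sum.inr i, Sum.inl u => u ∈ i.1.2
  | Sum.inr i, Sum.inr j => i ≠ j ∧
      (i.1.1 = j.1.1 ∨ i.1.2 = j.1.2 ∨ s(i.1.1, j.1.1) = i.1.2 ∨ s(i.1.1, j.1.1) = j.1.2)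

/-- A vi-simultaneous proper `k`-coloring of `G`: adjacent or incident elements of
`V(G) ∪ I(G)` receive distinct colors. -/
def IsVIColoring (G : SimpleGraph V) {k : ℕ} (c : VIElem G → Fin k) : Prop :=
  ∀ a b, VIAdj G a b → c a ≠ c b

/-- The vi-simultaneous chromatic number `χ_vi(G)`: the least `k` admitting a
vi-simultaneous proper `k`-coloring. -/
noncomputable def chiVI (G : SimpleGraph V) : ℕ :=
  sInf {k | ∃ c : VIElem G → Fin k, IsVIColoring G c}

/-- `I₂(v)`: the set of second incidences of a vertex `v`, i.e. incidences `(u, e)` with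
`e = {u, v}` and `u ≠ v`. -/
def I2 (G : SimpleGraph V) (v : V) : Set (Inc G) :=
  {i | i.1.1 ≠ v ∧ i.1.2 = s(i.1.1, v)}

/-- A vi-simultaneous `(k, s)`-coloring: a vi-simultaneous proper `k`-coloring in which at
most `s` distinct colors appear on `I₂(v)` for every vertex `v`. -/
def IsVISColoring (G : SimpleGraph V) (s : ℕ) {k : ℕ} (c : VIElem G → Fin k) : Prop :=
  IsVIColoring G c ∧ ∀ v : V, ((fun i => c (Sum.inr i)) '' I2 G v).ncard ≤ s

/-- `χ_{vi,s}(G)`: the least `k` admitting a vi-simultaneous `(k, s)`-coloring. -/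
noncomputable def chiVIS (G : SimpleGraph V) (s : ℕ) : ℕ :=
  sInf {k | ∃ c : VIElem G → Fin k, IsVISColoring G s c}

/-- The maximum degree `Δ(G)` of a finite graph. -/
noncomputable def maxDeg [Fintype V] (G : SimpleGraph V) : ℕ :=
  Finset.univ.sup fun v => (G.neighborSet v).ncard

namespace SimpleGraph

/-- A pair of vertex labelings encoding a vi-simultaneous coloring in which all second incidences
of a vertex share one color: `c` colors the vertices and `f v` is the color used on `I₂(v)`. -/
structure IsVIPair {α : Type*} (G : SimpleGraph V) (c f : V → α) : Prop where
  vertex_ne : ∀ u v, G.Adj u v → c u ≠ c v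
  vertex_ne_own : ∀ u v, G.Adj u v → c u ≠ f u
  vertex_ne_second : ∀ u v, G.Adj u v → c u ≠ f v
  second_ne : ∀ u v, G.Adj u v → f u ≠ f v
  second_ne_of_common : ∀ v x z, G.Adj v x → G.Adj v z → x ≠ z → f x ≠ f z

/-- A locally injective homomorphism to the 4-cycle on `ZMod 4`. -/
structure IsPhase (G : SimpleGraph V) (q : V → ZMod 4) : Prop where
  adj : ∀ u v, G.Adj u v → q v = q u + 1 ∨ q v = q u - 1
  ne_of_common : ∀ v x z, G.Adj v x → G.Adj v z → x ≠ z → q x ≠ q z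

variable {G : SimpleGraph V}

/-- The incidence `(u, uv)` of an edge `uv`. -/
def Adj.inc {u v : V} (h : G.Adj u v) : Inc G :=
  ⟨(u, s(u, v)), h, Sym2.mem_mk_left u v⟩

lemma Adj.inc_mem_I2 {u v : V} (h : G.Adj u v) : h.inc ∈ I2 G v :=
  ⟨h.ne, rfl⟩

lemma exists_inc_eq (i : Inc G) : ∃ u v, ∃ h : G.Adj u v, i = h.inc := by
  obtain ⟨⟨u, e⟩, he, hu⟩ := i
  obtain ⟨v, rfl : e = s(u, v)⟩ := Sym2.mem_iff_exists.mp hu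
  exact ⟨u, v, he, rfl⟩

lemma exists_second_color [Finite V] {k : ℕ} {c : VIElem G → Fin k} (hc : IsVISColoring G 1 c) :
    ∃ f : V → Fin k, ∀ u v (h : G.Adj u v), c (Sum.inr h.inc) = f v := by
  classical
  refine ⟨fun v ↦ if h : ∃ u, G.Adj u v then c (Sum.inr h.choose_spec.inc) else c (Sum.inl v), ?_⟩
  intro u v h
  have hex : ∃ u, G.Adj u v := ⟨u, h⟩
  simp only [dif_pos hex]
  exact (Set.ncard_le_one (Set.toFinite _)).mp (hc.2 v) _ ⟨_, h.inc_mem_I2, rfl⟩ _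
    ⟨_, hex.choose_spec.inc_mem_I2, rfl⟩

lemma _root_.IsVISColoring.exists_isVIPair [Finite V] {k : ℕ} {c : VIElem G → Fin k}
    (hc : IsVISColoring G 1 c) : ∃ d f : V → Fin k, G.IsVIPair d f := by
  obtain ⟨f, hf⟩ := exists_second_color hc
  refine ⟨fun v ↦ c (Sum.inl v), f, ?_, ?_, ?_, ?_, ?_⟩
  · exact fun u v h ↦ hc.1 _ _ h
  · intro u v h
    rw [← hf v u h.symm]
    exact hc.1 _ _ (by simp [VIAdj, Adj.inc])
  · intro u v h
    rw [← hf u v h]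
    exact hc.1 _ _ (by simp [VIAdj, Adj.inc])
  · intro u v h
    rw [← hf u v h, ← hf v u h.symm]
    exact hc.1 _ _ (by simp [VIAdj, Adj.inc, h.ne', Sym2.eq_swap])
  · intro v x z hx hz hxz
    rw [← hf v x hx, ← hf v z hz]
    exact hc.1 _ _ ⟨fun e ↦ hxz (Sym2.congr_right.mp (congrArg (·.1.2) e)), Or.inl rfl⟩

lemma IsVIPair.exists_isVISColoring {k : ℕ} {d f : V → Fin k} (h : G.IsVIPair d f) :
    ∃ c : VIElem G → Fin k, IsVISColoring G 1 c := by
  let c : VIElem G → Fin k := Sum.elim d fun i ↦ f (Sym2.Mem.other i.2.2)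
  have hinc : ∀ u v (huv : G.Adj u v), c (Sum.inr huv.inc) = f v := fun u v huv ↦
    congrArg f (Sym2.congr_right.mp (Sym2.other_spec huv.inc.2.2))
  have hvi : ∀ u x y (hxy : G.Adj x y), u ∈ s(x, y) → d u ≠ f y := by
    intro u x y hxy hu
    rcases Sym2.mem_iff.mp hu with rfl | rfl
    · exact h.vertex_ne_second _ _ hxy
    · exact h.vertex_ne_own _ _ hxy.symm
  refine ⟨c, ?_, ?_⟩
  · rintro (u | i) (w | j) hadj
    · exact h.vertex_ne _ _ hadj
    · obtain ⟨x, y, hxy, rfl⟩ := exists_inc_eq j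
      rw [hinc]
      exact hvi _ _ _ hxy hadj
    · obtain ⟨x, y, hxy, rfl⟩ := exists_inc_eq i
      rw [hinc]
      exact (hvi _ _ _ hxy hadj).symm
    · obtain ⟨x, y, hxy, rfl⟩ := exists_inc_eq i
      obtain ⟨a, b, hab, rfl⟩ := exists_inc_eq j
      rw [hinc, hinc]
      obtain ⟨hne, hadj⟩ := hadj
      simp only [Adj.inc] at hadj hne
      rcases hadj with rfl | hadj | hadj | hadj
      · exact h.second_ne_of_common _ _ _ hxy hab fun hyb ↦ hne (by subst hyb; rfl)
      · rcases Sym2.eq_iff.mp hadj with ⟨rfl, rfl⟩ | ⟨rfl, rfl⟩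
        · exact absurd rfl hne
        · exact h.second_ne _ _ hab
      · obtain rfl := Sym2.congr_right.mp hadj
        exact h.second_ne _ _ hab
      · obtain rfl := Sym2.congr_right.mp (Sym2.eq_swap.trans hadj)
        exact (h.second_ne _ _ hxy).symm
  · intro v
    refine (Set.ncard_le_one (Set.toFinite _)).mpr ?_
    have key : ∀ i ∈ I2 G v, c (Sum.inr i) = f v := by
      intro i hi
      obtain ⟨x, y, hxy, rfl⟩ := exists_inc_eq i
      obtain rfl := Sym2.congr_right.mp hi.2
      exact hinc _ _ hxy
    rintro _ ⟨i, hi, rfl⟩ _ ⟨j, hj, rfl⟩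
    exact (key i hi).trans (key j hj).symm

lemma IsVIPair.four_le {k : ℕ} {d f : V → Fin k} (h : G.IsVIPair d f) {u v : V}
    (huv : G.Adj u v) : 4 ≤ k := by
  have hcard : ({d u, d v, f u, f v} : Finset (Fin k)).card = 4 := by
    rw [Finset.card_insert_of_notMem, Finset.card_insert_of_notMem, Finset.card_pair]
    · exact h.second_ne _ _ huv
    · simp [h.vertex_ne_second _ _ huv.symm, h.vertex_ne_own _ _ huv.symm]
    · simp [h.vertex_ne _ _ huv, h.vertex_ne_own _ _ huv, h.vertex_ne_second _ _ huv]
  simpa [hcard] using Finset.card_le_univ ({d u, d v, f u, f v} : Finset (Fin k))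

lemma IsPhase.exists_isVIPair {q : V → ZMod 4} (h : G.IsPhase q) :
    ∃ d f : V → Fin 4, G.IsVIPair d f := by
  have hstep : ∀ u v, G.Adj u v → q u ≠ q v ∧ q u ≠ q v + 2 := by
    have key : ∀ a : ZMod 4, (a ≠ a + 1 ∧ a ≠ a + 1 + 2) ∧ a ≠ a - 1 ∧ a ≠ a - 1 + 2 := by decide
    intro u v huv
    rcases h.adj u v huv with e | e <;> rw [e]
    exacts [(key _).1, (key _).2]
  have htwo : ∀ a : ZMod 4, a ≠ a + 2 := by decide
  exact ⟨fun v ↦ (ZMod.finEquiv 4).symm (q v), fun v ↦ (ZMod.finEquiv 4).symm (q v + 2),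
    fun u v huv ↦ (ZMod.finEquiv 4).symm.injective.ne (hstep u v huv).1,
    fun u _ _ ↦ (ZMod.finEquiv 4).symm.injective.ne (htwo _),
    fun u v huv ↦ (ZMod.finEquiv 4).symm.injective.ne (hstep u v huv).2,
    fun u v huv ↦ (ZMod.finEquiv 4).symm.injective.ne fun e ↦ (hstep u v huv).1 (add_right_cancel e),
    fun v x z hx hz hxz ↦ (ZMod.finEquiv 4).symm.injective.ne fun e ↦
      h.ne_of_common v x z hx hz hxz (add_right_cancel e)⟩

lemma chiVIS_one_eq_four_iff_exists_isVIPair [Finite V] (hedge : G.edgeSet.Nonempty) :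
    chiVIS G 1 = 4 ↔ ∃ d f : V → Fin 4, G.IsVIPair d f := by
  obtain ⟨⟨u, v⟩, huv⟩ := hedge
  constructor
  · intro h
    have hne : {k | ∃ c : VIElem G → Fin k, IsVISColoring G 1 c}.Nonempty :=
      Nat.nonempty_of_sInf_eq_succ h
    have hmem := Nat.sInf_mem hne
    obtain ⟨c, hc⟩ : ∃ c : VIElem G → Fin 4, IsVISColoring G 1 c := by
      rwa [show sInf {k | ∃ c : VIElem G → Fin k, IsVISColoring G 1 c} = 4 from h] at hmem
    exact hc.exists_isVIPair
  · rintro ⟨d, f, h⟩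
    refine IsLeast.csInf_eq ⟨h.exists_isVISColoring, ?_⟩
    rintro k ⟨c, hc⟩
    obtain ⟨d', f', h'⟩ := hc.exists_isVIPair
    exact h'.four_le huv

lemma indicator_sums_eq_one : ∀ a b p r s t : Fin 4, a ≠ p → a ≠ s → a ≠ b → p ≠ r → s ≠ t →
    a ≠ r → a ≠ t → p ≠ b → s ≠ b → b ≠ r → b ≠ t → r ≠ t →
    (if b = 0 then 1 else 0) + ((if r = 0 then 1 else 0) + if t = 0 then 1 else 0) +
      (if a = 0 then 1 else 0) = 1 ∧
    (if a = 0 then 1 else 0) + ((if p = 0 then 1 else 0) + if s = 0 then 1 else 0) +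
      (if b = 0 then 1 else 0) = 1 := by
  intro a b p r s t _ _ _ _ _ _ _ _ _ _ _ _
  obtain rfl : p = t := by omega
  obtain rfl : s = r := by omega
  simp only [Fin.ext_iff] at *
  split_ifs <;> omega

lemma IsTree.eq_of_dist_add_one_eq (hG : G.IsTree) {r v x z : V} (hx : G.Adj v x)
    (hz : G.Adj v z) (hdx : G.dist r x + 1 = G.dist r v) (hdz : G.dist r z + 1 = G.dist r v) :
    x = z := by
  have key : ∀ y, G.Adj v y → G.dist r y + 1 = G.dist r v →
      ∃ p : G.Walk r v, p.IsPath ∧ p.penultimate = y := by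
    intro y hy hd
    obtain ⟨p, hp⟩ := hG.connected.exists_walk_length_eq_dist r y
    refine ⟨p.concat hy.symm, Walk.isPath_of_length_eq_dist _ (by simp [hp, hd]), by simp⟩
  obtain ⟨p, hp, rfl⟩ := key x hx hdx
  obtain ⟨p', hp', rfl⟩ := key z hz hdz
  rw [(hG.existsUnique_path r v).unique hp hp']

section Finite

variable [Fintype V]

lemma four_dvd_card_of_isVIPair {d f : V → Fin 4} (h : G.IsVIPair d f)
    (hreg : ∀ v, (G.neighborSet v).ncard = 2) : 4 ∣ Fintype.card V := by
  classical
  have hdeg : ∀ v, (G.neighborFinset v).card = 2 := fun v ↦ by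
    rw [← hreg v, Set.ncard_eq_toFinset_card']; rfl
  have hsum : ∀ F : V → ℕ, ∑ v, ∑ w ∈ G.neighborFinset v, F w = 2 * ∑ v, F v := by
    intro F
    rw [Finset.sum_comm' (t' := Finset.univ) (s' := fun w ↦ G.neighborFinset w)
      (by simp [adj_comm]), Finset.mul_sum]
    simp [hdeg]
  have hloc : ∀ v,
      (if f v = 0 then 1 else 0) + (∑ w ∈ G.neighborFinset v, if f w = 0 then 1 else 0) +
        (if d v = 0 then 1 else 0) = 1 ∧
      (if d v = 0 then 1 else 0) + (∑ w ∈ G.neighborFinset v, if d w = 0 then 1 else 0) +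
        (if f v = 0 then 1 else 0) = 1 := by
    intro v
    obtain ⟨x, z, hxz, hN⟩ := Finset.card_eq_two.mp (hdeg v)
    have hx : G.Adj v x := by simp [← mem_neighborFinset, hN]
    have hz : G.Adj v z := by simp [← mem_neighborFinset, hN]
    rw [hN, Finset.sum_pair hxz, Finset.sum_pair hxz]
    have h1 := h.vertex_ne _ _ hx
    have h2 := h.vertex_ne _ _ hz
    have h3 := h.vertex_ne_own _ _ hx
    have h4 := h.vertex_ne_own _ _ hx.symm
    have h5 := h.vertex_ne_own _ _ hz.symm
    have h6 := h.vertex_ne_second _ _ hx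
    have h7 := h.vertex_ne_second _ _ hz
    have h8 := h.vertex_ne_second _ _ hx.symm
    have h9 := h.vertex_ne_second _ _ hz.symm
    have h10 := h.second_ne _ _ hx
    have h11 := h.second_ne _ _ hz
    have h12 := h.second_ne_of_common _ _ _ hx hz hxz
    exact indicator_sums_eq_one _ _ _ _ _ _ h1 h2 h3 h4 h5 h6 h7 h8 h9 h10 h11 h12
  have hf := Finset.sum_congr (rfl : (Finset.univ : Finset V) = _) fun v _ ↦ (hloc v).1
  have hd := Finset.sum_congr (rfl : (Finset.univ : Finset V) = _) fun v _ ↦ (hloc v).2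
  rw [Finset.sum_add_distrib, Finset.sum_add_distrib, hsum] at hf hd
  simp only [Finset.sum_const, Finset.card_univ, smul_eq_mul, mul_one] at hf hd
  omega

/-- A connected graph of maximum degree at most 2 is 2-regular or a tree. -/
lemma Connected.isAcyclic_or_ncard_neighborSet_eq_two (hconn : G.Connected)
    (hdeg : ∀ v, (G.neighborSet v).ncard ≤ 2) :
    (∀ v, (G.neighborSet v).ncard = 2) ∨ G.IsAcyclic := by
  classical
  by_contra! hcon
  obtain ⟨⟨v, hv⟩, hcyc⟩ := hcon
  have hncard : ∀ v, (G.neighborSet v).ncard = G.degree v := fun v ↦ by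
    rw [Set.ncard_eq_toFinset_card']; rfl
  simp only [hncard] at hdeg hv
  have hlt : ∑ v, G.degree v < ∑ _v : V, 2 :=
    Finset.sum_lt_sum (fun v _ ↦ hdeg v) ⟨v, Finset.mem_univ v, lt_of_le_of_ne (hdeg v) hv⟩
  rw [sum_degrees_eq_twice_card_edges] at hlt
  have hle := hconn.card_vert_le_card_edgeSet_add_one
  refine hcyc (isTree_iff_connected_and_card.mpr ⟨hconn, ?_⟩).isAcyclic
  rw [← coe_edgeFinset, Nat.card_coe_set_eq, Set.ncard_coe_finset, Nat.card_eq_fintype_card] at *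
  simp at hlt
  omega

lemma IsTree.exists_ncard_neighborSet_le_one (hG : G.IsTree) :
    ∃ r, (G.neighborSet r).ncard ≤ 1 := by
  classical
  rcases subsingleton_or_nontrivial V with hV | hV
  · obtain ⟨r⟩ := hG.connected.nonempty
    exact ⟨r, Set.ncard_le_one_of_subsingleton _⟩
  · obtain ⟨r, hr⟩ := hG.exists_vert_degree_one_of_nontrivial
    refine ⟨r, le_of_eq ?_⟩
    rw [← hr, Set.ncard_eq_toFinset_card']
    rfl

lemma IsTree.exists_isPhase (hG : G.IsTree) (hdeg : ∀ v, (G.neighborSet v).ncard ≤ 2) :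
    ∃ q, G.IsPhase q := by
  obtain ⟨r, hr⟩ := hG.exists_ncard_neighborSet_le_one
  refine ⟨fun v ↦ (G.dist r v : ZMod 4), ?_, ?_⟩
  · intro u v huv
    rcases hG.dist_eq_dist_add_one_of_adj r huv with h | h
    · right; simp [h]
    · left; simp [h]
  · intro v x z hx hz hxz
    have hstep : ∀ n : ℕ, ((n + 1 + 1 : ℕ) : ZMod 4) ≠ n := by
      intro n; push_cast; generalize (n : ZMod 4) = a; revert a; decide
    rcases hG.dist_eq_dist_add_one_of_adj r hx with h | h <;>
      rcases hG.dist_eq_dist_add_one_of_adj r hz with h' | h'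
    · exact absurd (hG.eq_of_dist_add_one_eq hx hz h.symm h'.symm) hxz
    · simp only [h', h]; exact (hstep _).symm
    · simp only [h', h]; exact hstep _
    · exfalso
      rcases eq_or_ne r v with rfl | hrv
      · exact hxz ((Set.ncard_le_one (Set.toFinite _)).mp hr x hx z hz)
      · obtain ⟨p, hp⟩ := hG.connected.exists_walk_length_eq_dist r v
        have hnil : ¬ p.Nil := fun hn ↦ hrv hn.eq
        have hadj := (p.adj_penultimate hnil).symm
        have hle := G.dist_le p.dropLast
        have hpos := Walk.not_nil_iff_lt_length.mp hnil
        have hlen : p.dropLast.length = p.length - 1 := by simp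
        have hpx : p.penultimate ≠ x := ne_of_apply_ne (G.dist r) (by omega)
        have hpz : p.penultimate ≠ z := ne_of_apply_ne (G.dist r) (by omega)
        have hsub : ({p.penultimate, x, z} : Set V) ⊆ G.neighborSet v := by
          rintro y (rfl | rfl | rfl) <;> assumption
        have hcard := Set.ncard_le_ncard hsub (Set.toFinite _)
        rw [Set.ncard_eq_three.mpr ⟨_, _, _, hpx, hpz, hxz, rfl⟩] at hcard
        exact absurd (hcard.trans (hdeg v)) (by norm_num)

lemma Connected.exists_isPhase_of_four_dvd_card (hconn : G.Connected)
    (hreg : ∀ v, (G.neighborSet v).ncard = 2) (hcard : 4 ∣ Fintype.card V) :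
    ∃ q, G.IsPhase q := by
  classical
  obtain ⟨r⟩ := hconn.nonempty
  have hcyc : G.IsCycles := fun v _ ↦ hreg v
  obtain ⟨p, hp, hverts⟩ := hcyc.exists_cycle_toSubgraph_verts_eq_connectedComponentSupp
    (c := G.connectedComponentMk r) rfl
    (Set.nonempty_of_ncard_ne_zero (by rw [hreg r]; norm_num))
  have hsupp : ∀ v, v ∈ p.support := fun v ↦ by
    rw [← Walk.mem_verts_toSubgraph, hverts]
    exact ConnectedComponent.sound (hconn v r)
  have hlen3 := hp.three_le_length
  have hsurj : ∀ v, ∃ i, 1 ≤ i ∧ i ≤ p.length ∧ p.getVert i = v := by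
    intro v
    obtain ⟨i, hi, hil⟩ := Walk.mem_support_iff_exists_getVert.mp (hsupp v)
    rcases Nat.eq_zero_or_pos i with rfl | hpos
    · refine ⟨p.length, by omega, le_rfl, ?_⟩
      rw [← hi]; simp
    · exact ⟨i, hpos, hil, hi⟩
  have hlen : 4 ∣ p.length := by
    convert hcard
    rw [← Finset.card_univ, ← Nat.add_sub_cancel (n := p.length) (m := 1), ← Nat.card_Icc]
    refine Finset.card_bij (fun i _ ↦ p.getVert i) (by simp) ?_ ?_
    · intro i hi j hj hij
      exact hp.getVert_injOn (by simpa using hi) (by simpa using hj) hij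
    · intro v _
      obtain ⟨i, h1, h2, h3⟩ := hsurj v
      exact ⟨i, by simp [h1, h2], h3⟩
  choose idx hidx1 hidx2 hidx using hsurj
  have hlen0 : ((p.length : ℕ) : ZMod 4) = 0 := (ZMod.natCast_eq_zero_iff _ _).mpr hlen
  have hq : ∀ i ≤ p.length, (idx (p.getVert i) : ZMod 4) = i := by
    intro i hi
    rcases Nat.eq_zero_or_pos i with rfl | hpos
    · have : idx (p.getVert 0) = p.length :=
        hp.getVert_injOn ⟨hidx1 _, hidx2 _⟩ ⟨by omega, le_rfl⟩ (by rw [hidx]; simp)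
      rw [this, hlen0, Nat.cast_zero]
    · rw [hp.getVert_injOn ⟨hidx1 _, hidx2 _⟩ ⟨hpos, hi⟩ (hidx _)]
  have hnbr : ∀ v, ∃ a b, G.neighborSet v = {a, b} ∧ (idx a : ZMod 4) = idx v - 1 ∧
      (idx b : ZMod 4) = idx v + 1 := by
    intro v
    obtain ⟨i, hi⟩ : ∃ i, idx v = i + 1 := ⟨idx v - 1, by have := hidx1 v; omega⟩
    have hil := hidx2 v
    have hv := hidx v
    rw [hi] at hil hv
    have ha : G.Adj v (p.getVert i) := by
      rw [← hv]; exact (p.adj_getVert_succ (by omega)).symm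
    obtain ⟨b, hb, hab, hqb⟩ : ∃ b, G.Adj v b ∧ p.getVert i ≠ b ∧
        (idx b : ZMod 4) = idx v + 1 := by
      rcases hil.eq_or_lt with he | hlt
      · refine ⟨p.getVert 1, ?_, ?_, ?_⟩
        · have := p.adj_getVert_succ (i := 0) (by omega)
          rw [← hv, he]
          simpa using this
        · have := hp.snd_ne_penultimate.symm
          rwa [Walk.penultimate, ← he, Nat.add_sub_cancel] at this
        · rw [hq 1 (by omega), hi, he, hlen0]; simp
      · refine ⟨p.getVert (i + 2), ?_, ?_, ?_⟩
        · rw [← hv]; exact p.adj_getVert_succ hlt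
        · simpa using hp.getVert_sub_one_ne_getVert_add_one (i := i + 1) (by omega)
        · rw [hq _ (by omega), hi]; push_cast; ring
    refine ⟨p.getVert i, b, ?_, ?_, hqb⟩
    · refine (Set.eq_of_subset_of_ncard_le ?_ ?_ (Set.toFinite _)).symm
      · rintro y (rfl | rfl) <;> assumption
      · rw [hreg, Set.ncard_pair hab]
    · rw [hq _ (by omega), hi]; simp
  refine ⟨fun v ↦ idx v, ?_, ?_⟩
  · intro u v huv
    obtain ⟨a, b, hN, ha, hb⟩ := hnbr u
    have : v ∈ ({a, b} : Set V) := hN ▸ huv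
    rcases this with rfl | rfl
    · exact Or.inr ha
    · exact Or.inl hb
  · intro v x z hx hz hxz
    obtain ⟨a, b, hN, ha, hb⟩ := hnbr v
    have hx' : x ∈ ({a, b} : Set V) := hN ▸ hx
    have hz' : z ∈ ({a, b} : Set V) := hN ▸ hz
    have hne : ∀ t : ZMod 4, t - 1 ≠ t + 1 := by decide
    rcases hx' with rfl | rfl <;> rcases hz' with rfl | rfl
    · exact absurd rfl hxz
    · simp only [ha, hb]; exact hne _
    · simp only [ha, hb]; exact (hne _).symm
    · exact absurd rfl hxz

end Finite

lemma IsVIPair.comap {W α : Type*} {H : SimpleGraph W} {d f : V → α} (h : G.IsVIPair d f)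
    (φ : H ↪g G) : H.IsVIPair (d ∘ φ) (f ∘ φ) where
  vertex_ne _ _ huv := h.vertex_ne _ _ (φ.map_adj_iff.mpr huv)
  vertex_ne_own _ _ huv := h.vertex_ne_own _ _ (φ.map_adj_iff.mpr huv)
  vertex_ne_second _ _ huv := h.vertex_ne_second _ _ (φ.map_adj_iff.mpr huv)
  second_ne _ _ huv := h.second_ne _ _ (φ.map_adj_iff.mpr huv)
  second_ne_of_common _ _ _ hx hz hxz := h.second_ne_of_common _ _ _ (φ.map_adj_iff.mpr hx)
    (φ.map_adj_iff.mpr hz) (φ.injective.ne hxz)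

lemma exists_isPhase_of_forall_component
    (h : ∀ C : G.ConnectedComponent, ∃ q, (G.induce C.supp).IsPhase q) : ∃ q, G.IsPhase q := by
  choose q hq using h
  let Q : V → ZMod 4 := fun v ↦ q (G.connectedComponentMk v) ⟨v, rfl⟩
  have hQ : ∀ C (w : C.supp), Q w = q C w := by
    rintro C ⟨w, rfl⟩
    rfl
  refine ⟨Q, ?_, ?_⟩
  · intro u v huv
    let C := G.connectedComponentMk u
    have hv : v ∈ C.supp := ConnectedComponent.sound huv.symm.reachable
    rw [hQ C ⟨u, rfl⟩, hQ C ⟨v, hv⟩]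
    exact (hq C).adj _ _ huv
  · intro v x z hx hz hxz
    let C := G.connectedComponentMk v
    have hx' : x ∈ C.supp := ConnectedComponent.sound hx.symm.reachable
    have hz' : z ∈ C.supp := ConnectedComponent.sound hz.symm.reachable
    rw [hQ C ⟨x, hx'⟩, hQ C ⟨z, hz'⟩]
    exact (hq C).ne_of_common ⟨v, rfl⟩ _ _ hx hz fun e ↦ hxz (congrArg Subtype.val e)

lemma ConnectedComponent.ncard_neighborSet_induce_supp (C : G.ConnectedComponent) (v : C.supp) :
    ((G.induce C.supp).neighborSet v).ncard = (G.neighborSet v).ncard := by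
  rw [← Set.ncard_image_of_injective _ Subtype.val_injective]
  congr 1
  ext w
  constructor
  · rintro ⟨w, hw, rfl⟩
    exact hw
  · intro hw
    exact ⟨⟨w, (C.mem_supp_congr_adj hw).mp v.2⟩, hw, rfl⟩

end SimpleGraph

/-- Let `G` be a finite simple graph with at least one edge and maximum
degree `Δ(G) ≤ 2`. Then `χ_{vi,1}(G) = 4` iff every connected component of `G` is either
a cycle whose order is divisible by 4 (equivalently, since `Δ(G) ≤ 2`, a component all of
whose vertices have degree 2, with `4 ∣ |C|`) or a path (equivalently, since `Δ(G) ≤ 2`,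
an acyclic component). -/
theorem chiVIS_one_eq_four_iff {V : Type*} [Fintype V] [DecidableEq V]
    (G : SimpleGraph V) (hedge : G.edgeSet.Nonempty) (hΔ : maxDeg G ≤ 2) :
    chiVIS G 1 = 4 ↔
      ∀ C : G.ConnectedComponent,
        ((∀ v ∈ C.supp, (G.neighborSet v).ncard = 2) ∧ C.supp.ncard % 4 = 0) ∨
        (SimpleGraph.induce C.supp G).IsAcyclic := by
  classical
  have hdeg : ∀ (C : G.ConnectedComponent) v, ((G.induce C.supp).neighborSet v).ncard ≤ 2 :=
    fun C v ↦ (C.ncard_neighborSet_induce_supp v).trans_le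
      ((Finset.le_sup (f := fun v ↦ (G.neighborSet v).ncard) (Finset.mem_univ v.1)).trans hΔ)
  have hcard : ∀ C : G.ConnectedComponent, Fintype.card C.supp = C.supp.ncard := fun C ↦ by
    rw [← Nat.card_coe_set_eq, Nat.card_eq_fintype_card]
  have hconn : ∀ C : G.ConnectedComponent, (G.induce C.supp).Connected :=
    fun C ↦ C.connected_toSimpleGraph
  rw [chiVIS_one_eq_four_iff_exists_isVIPair hedge]
  constructor
  · rintro ⟨d, f, h⟩ C
    refine ((hconn C).isAcyclic_or_ncard_neighborSet_eq_two (hdeg C)).imp_left fun hreg ↦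
      ⟨fun v hv ↦ ?_, ?_⟩
    · rw [← hreg ⟨v, hv⟩, C.ncard_neighborSet_induce_supp]
    · rw [← hcard]
      exact Nat.mod_eq_zero_of_dvd
        (four_dvd_card_of_isVIPair (h.comap (Embedding.induce C.supp)) hreg)
  · intro h
    obtain ⟨q, hq⟩ := exists_isPhase_of_forall_component fun C ↦ by
      rcases h C with ⟨hreg, hmod⟩ | hacyc
      · refine (hconn C).exists_isPhase_of_four_dvd_card (fun v ↦ ?_) ?_
        · rw [C.ncard_neighborSet_induce_supp, hreg _ v.2]
        · rw [hcard]
          exact Nat.dvd_of_mod_eq_zero hmod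
      · exact IsTree.exists_isPhase ⟨hconn C, hacyc⟩ (hdeg C)
    exact hq.exists_isVIPair
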